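/- Let (u,θ) be a classical solution of the thermal Navier–Stokes system on 𝕋³ × [0,T] with θ₀ ≥ 1 on 𝕋³. Then inf_{x ∈ 𝕋³} θ(x,t) ≥ 1 for every t ∈ [0,T]. -/

import Mathlib

open MeasureTheory Real
open scoped ENNReal

noncomputable section

/-- Points of `ℝ³`; `ℤ³`-periodic functions on `Sp` model functions on the torus `𝕋³`. -/
abbrev Sp : Type := Fin 3 → ℝ

/-- A fundamental cell for the torus `𝕋³ = ℝ³/ℤ³`; integrals over `𝕋³` are integrals
over `cell`. -/
def cell : Set Sp := Set.Icc 0 1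

/-- The `i`-th partial derivative `∂ᵢ f`. -/
def pd (i : Fin 3) (f : Sp → ℝ) (x : Sp) : ℝ := fderiv ℝ f x (Pi.single i 1)

/-- `ℤ³`-periodicity: such a function descends to the torus `𝕋³`. -/
def Periodic3 (f : Sp → ℝ) : Prop :=
  ∀ (x : Sp) (k : Fin 3 → ℤ), f (x + fun i => (k i : ℝ)) = f x

/-- `|∇u|²` for a vector field `u`. -/
def gradSqV (u : Sp → Fin 3 → ℝ) (x : Sp) : ℝ :=
  ∑ i, ∑ j, (pd i (fun y => u y j) x) ^ 2

/-- `|∇²u|²` for a vector field `u`. -/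
def hessSqV (u : Sp → Fin 3 → ℝ) (x : Sp) : ℝ :=
  ∑ i, ∑ j, ∑ k, (pd i (pd j (fun y => u y k)) x) ^ 2

/-- `|∇f|²` for a scalar field `f`. -/
def gradSqS (f : Sp → ℝ) (x : Sp) : ℝ := ∑ i, (pd i f x) ^ 2

/-- An axis-parallel cube in `ℝ³` with base point `a` and side length `r`. -/
def cube (a : Sp) (r : ℝ) : Set Sp := Set.Icc a (a + fun _ => r)

/-- The average `|Q|⁻¹ ∫_Q f dx` of a nonnegative function, valued in `ℝ≥0∞`. -/
def avgE (Q : Set Sp) (f : Sp → ℝ) : ℝ≥0∞ :=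
  (volume Q)⁻¹ * ∫⁻ x in Q, ENNReal.ofReal (f x)

/-- The Muckenhoupt `A₂` characteristic `Q₂(ω)`, the supremum over all cubes `Q ⊆ 𝕋³`
(side length `≤ 1`) of `(|Q|⁻¹∫_Q ω dx)(|Q|⁻¹∫_Q ω⁻¹ dx)`; `ω ∈ A₂` iff `Q2 ω < ⊤`. -/
def Q2 (ω : Sp → ℝ) : ℝ≥0∞ :=
  ⨆ (a : Sp) (r : ℝ) (_ : 0 < r) (_ : r ≤ 1),
    avgE (cube a r) ω * avgE (cube a r) fun x => (ω x)⁻¹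

/-- A classical solution `(u, θ)` (with pressure `p`) of the thermal Navier–Stokes system
`∂ₜu + (u·∇)u + ∇p − ν div(θ∇u) = 0`, `div u = 0`,
`∂ₜ(θ²) + u·∇(θ²) − κ div(θ∇(θ²)) = νθ|∇u|²` on `𝕋³ × [0,T]`, with `p` the mean-zero
solution of `Δp = ∂ᵢ∂ⱼ(νθ∂ᵢuⱼ − uᵢuⱼ)`, initial data `u₀` mean-zero and `θ₀ ≥ 1`. -/
structure ThermalNSE (ν κ T : ℝ) (u : ℝ → Sp → Fin 3 → ℝ) (θ : ℝ → Sp → ℝ)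
    (p : ℝ → Sp → ℝ) : Prop where
  T_pos : 0 < T
  smooth_u : ContDiff ℝ (⊤ : ℕ∞) fun q : ℝ × Sp => u q.1 q.2
  smooth_θ : ContDiff ℝ (⊤ : ℕ∞) fun q : ℝ × Sp => θ q.1 q.2
  smooth_p : ContDiff ℝ (⊤ : ℕ∞) fun q : ℝ × Sp => p q.1 q.2
  periodic_u : ∀ t j, Periodic3 fun x => u t x j
  periodic_θ : ∀ t, Periodic3 (θ t)
  periodic_p : ∀ t, Periodic3 (p t)
  div_free : ∀ t ∈ Set.Icc (0 : ℝ) T, ∀ x, (∑ i, pd i (fun y => u t y i) x) = 0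
  momentum : ∀ t ∈ Set.Icc (0 : ℝ) T, ∀ x, ∀ j,
    deriv (fun s => u s x j) t
      + (∑ i, u t x i * pd i (fun y => u t y j) x)
      + pd j (p t) x
      - ν * ∑ i, pd i (fun y => θ t y * pd i (fun z => u t z j) y) x = 0
  heat : ∀ t ∈ Set.Icc (0 : ℝ) T, ∀ x,
    deriv (fun s => θ s x ^ 2) t
      + (∑ i, u t x i * pd i (fun y => θ t y ^ 2) x)
      - κ * (∑ i, pd i (fun y => θ t y * pd i (fun z => θ t z ^ 2) y) x)
      = ν * θ t x * gradSqV (u t) x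
  p_mean_zero : ∀ t ∈ Set.Icc (0 : ℝ) T, ∫ x in cell, p t x = 0
  p_poisson : ∀ t ∈ Set.Icc (0 : ℝ) T, ∀ x,
    (∑ i, pd i (pd i (p t)) x)
      = ∑ i, ∑ j, pd i (pd j fun y =>
          ν * θ t y * pd i (fun z => u t z j) y - u t y i * u t y j) x
  u0_mean_zero : ∀ j, ∫ x in cell, u 0 x j = 0
  θ0_ge_one : ∀ x, 1 ≤ θ 0 x

/-- `pd i f` is the derivative along the `i`-th coordinate line. -/
theorem hasDerivAt_line {f : Sp → ℝ} (hf : Differentiable ℝ f) (i : Fin 3) (x : Sp) (s : ℝ) :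
    HasDerivAt (fun r : ℝ => f (x + r • Pi.single i (1 : ℝ)))
      (pd i f (x + s • Pi.single i (1 : ℝ))) s := by
  have h1 : HasDerivAt (fun r : ℝ => x + r • (Pi.single i (1 : ℝ) : Sp))
      (Pi.single i (1 : ℝ)) s := by
    simpa using ((hasDerivAt_id s).smul_const (Pi.single i (1 : ℝ) : Sp)).const_add x
  exact (hf _).hasFDerivAt.comp_hasDerivAt s h1

theorem contDiff_pd {f : Sp → ℝ} (hf : ContDiff ℝ (⊤ : ℕ∞) f) (i : Fin 3) :
    ContDiff ℝ (⊤ : ℕ∞) (pd i f) :=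
  (hf.fderiv_right (m := (⊤ : ℕ∞)) (by simp)).clm_apply contDiff_const

theorem pd_mul {f g : Sp → ℝ} {x : Sp} (hf : DifferentiableAt ℝ f x)
    (hg : DifferentiableAt ℝ g x) (i : Fin 3) :
    pd i (fun y => f y * g y) x = f x * pd i g x + g x * pd i f x := by
  simp [pd, fderiv_fun_mul hf hg]

theorem pd_eq_zero_of_isMin {f : Sp → ℝ} {x : Sp} (hx : ∀ y, f x ≤ f y) (i : Fin 3) :
    pd i f x = 0 := by
  have : IsLocalMin f x := Filter.Eventually.of_forall hx
  simp [pd, this.fderiv_eq_zero]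

/-- The second derivative is nonnegative at a local minimum. -/
theorem IsLocalMin.deriv_deriv_nonneg {f : ℝ → ℝ} {a : ℝ} (hmin : IsLocalMin f a)
    (hc : ContinuousAt f a) : 0 ≤ deriv (deriv f) a := by
  by_contra! hneg
  have hmax : IsLocalMax f a := isLocalMax_of_deriv_deriv_neg hneg hmin.deriv_eq_zero hc
  have hconst : f =ᶠ[nhds a] fun _ => f a := by
    filter_upwards [hmin, hmax] with y h1 h2 using le_antisymm h2 h1
  have : deriv (deriv f) a = 0 := by
    rw [hconst.deriv.deriv_eq]
    simp
  exact hneg.ne this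

theorem pd_pd_nonneg_of_isMin {f : Sp → ℝ} (hf : ContDiff ℝ (⊤ : ℕ∞) f) {x : Sp}
    (hx : ∀ y, f x ≤ f y) (i : Fin 3) : 0 ≤ pd i (pd i f) x := by
  have hd : Differentiable ℝ f := hf.differentiable (by simp)
  have hd' : Differentiable ℝ (pd i f) := (contDiff_pd hf i).differentiable (by simp)
  have h1 : deriv (fun r : ℝ => f (x + r • Pi.single i (1 : ℝ)))
      = fun s => pd i f (x + s • Pi.single i (1 : ℝ)) :=
    funext fun s => (hasDerivAt_line hd i x s).deriv
  have h2 := IsLocalMin.deriv_deriv_nonneg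
    (f := fun r : ℝ => f (x + r • Pi.single i (1 : ℝ))) (a := 0)
    (Filter.Eventually.of_forall fun s => by simpa using hx _)
    (hasDerivAt_line hd i x 0).continuousAt
  rw [h1, (hasDerivAt_line hd' i x 0).deriv] at h2
  simpa using h2

/-- Every point of `ℝ³` has a `ℤ³`-translate in the fundamental cell. -/
theorem exists_translate_mem_cell (x : Sp) :
    ∃ k : Fin 3 → ℤ, (x + fun i => (k i : ℝ)) ∈ cell := by
  refine ⟨fun i => -⌊x i⌋, fun i => ?_, fun i => ?_⟩
  · have := Int.floor_le (x i)
    simp only [Pi.zero_apply, Pi.add_apply, Int.cast_neg]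
    linarith
  · have := Int.lt_floor_add_one (x i)
    simp only [Pi.one_apply, Pi.add_apply, Int.cast_neg]
    linarith

/-- At a positive spatial minimum of the temperature, `∂ₜ(θ²) ≥ 0`. -/
theorem ThermalNSE.deriv_sq_nonneg_of_isMin {ν κ T : ℝ} (hν : 0 < ν) (hκ : 0 < κ)
    {u : ℝ → Sp → Fin 3 → ℝ} {θ p : ℝ → Sp → ℝ} (h : ThermalNSE ν κ T u θ p)
    {t : ℝ} (ht : t ∈ Set.Icc (0 : ℝ) T) {x : Sp} (hpos : 0 < θ t x)
    (hmin : ∀ y, θ t x ≤ θ t y) : 0 ≤ deriv (fun s => θ s x ^ 2) t := by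
  have hθ : ContDiff ℝ (⊤ : ℕ∞) (θ t) :=
    h.smooth_θ.comp (contDiff_const.prodMk contDiff_id)
  have hw : ContDiff ℝ (⊤ : ℕ∞) fun y => θ t y ^ 2 := hθ.pow 2
  have hwmin : ∀ y, θ t x ^ 2 ≤ θ t y ^ 2 := fun y => pow_le_pow_left₀ hpos.le (hmin y) 2
  have hgrad : ∀ i, pd i (fun y => θ t y ^ 2) x = 0 := pd_eq_zero_of_isMin hwmin
  have hdiff : 0 ≤ ∑ i, pd i (fun y => θ t y * pd i (fun z => θ t z ^ 2) y) x := by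
    refine Finset.sum_nonneg fun i _ => ?_
    rw [pd_mul (hθ.differentiable (by simp) x)
      ((contDiff_pd hw i).differentiable (by simp) x), hgrad i, zero_mul, add_zero]
    exact mul_nonneg hpos.le (pd_pd_nonneg_of_isMin hw hwmin i)
  have hsrc : 0 ≤ ν * θ t x * gradSqV (u t) x :=
    mul_nonneg (mul_pos hν hpos).le
      (Finset.sum_nonneg fun _ _ => Finset.sum_nonneg fun _ _ => sq_nonneg _)
  have heat := h.heat t ht x
  simp only [hgrad, mul_zero, Finset.sum_const_zero, add_zero] at heat
  linarith [mul_nonneg hκ.le hdiff]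

/-- **Proposition 2.1 (minimum principle), thermal Navier–Stokes.** If `θ₀ ≥ 1` on `𝕋³`,
then `inf_{x} θ(x,t) ≥ 1` for every `t ∈ [0,T]`. -/
theorem thermalNSE_temperature_min_principle (ν κ T : ℝ) (hν : 0 < ν) (hκ : 0 < κ)
    (u : ℝ → Sp → Fin 3 → ℝ) (θ p : ℝ → Sp → ℝ)
    (h : ThermalNSE ν κ T u θ p) :
    ∀ t ∈ Set.Icc (0 : ℝ) T, ∀ x : Sp, 1 ≤ θ t x := by
  intro t₀ ht₀ x₀
  by_contra! hlt
  obtain ⟨ε, hε, hε1, hε2⟩ : ∃ ε > 0, ε * (1 + T) < 1 ∧ ε * (1 + t₀) < 1 - θ t₀ x₀ := by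
    have hT : 0 < 1 + T := by linarith [h.T_pos]
    have ht : 0 < 1 + t₀ := by linarith [ht₀.1]
    obtain ⟨ε, h0, h1⟩ := exists_between
      (lt_min (div_pos one_pos hT) (div_pos (sub_pos.2 hlt) ht))
    exact ⟨ε, h0, (lt_div_iff₀ hT).1 (h1.trans_le (min_le_left _ _)),
      (lt_div_iff₀ ht).1 (h1.trans_le (min_le_right _ _))⟩
  have hcont : Continuous fun q : ℝ × Sp => θ q.1 q.2 := h.smooth_θ.continuous
  -- the first time at which `θ` touches the decreasing barrier `1 - ε * (1 + t)`
  let S : Set (ℝ × Sp) :=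
    (Set.Icc 0 t₀ ×ˢ cell) ∩ {q | θ q.1 q.2 ≤ 1 - ε * (1 + q.1)}
  have hS : IsCompact S :=
    (isCompact_Icc.prod isCompact_Icc).inter_right
      (isClosed_le hcont (by fun_prop))
  have hmemS : ∀ t ∈ Set.Icc 0 t₀, ∀ x, θ t x ≤ 1 - ε * (1 + t) → ∃ y, (t, y) ∈ S := by
    intro t ht x hx
    obtain ⟨k, hk⟩ := exists_translate_mem_cell x
    exact ⟨_, ⟨ht, hk⟩, (h.periodic_θ t x k).trans_le hx⟩
  obtain ⟨y₀, hy₀⟩ := hmemS t₀ ⟨ht₀.1, le_rfl⟩ x₀ (by linarith)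
  obtain ⟨⟨t, x⟩, ⟨⟨⟨ht0, htt₀⟩, -⟩, htouch⟩, hfirst⟩ :=
    hS.exists_isMinOn ⟨_, hy₀⟩ continuous_fst.continuousOn
  simp only [Set.mem_ofPred_eq] at ht0 htt₀ htouch
  have htT : t ≤ T := htt₀.trans ht₀.2
  have htpos : 0 < t := by
    refine ht0.lt_of_ne fun h0 => ?_
    subst h0
    linarith [h.θ0_ge_one x]
  have hbefore : ∀ s ∈ Set.Ioo 0 t, ∀ y, 1 - ε * (1 + s) < θ s y := by
    intro s hs y
    by_contra! hle
    obtain ⟨z, hz⟩ := hmemS s ⟨hs.1.le, hs.2.le.trans htt₀⟩ y hle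
    exact (isMinOn_iff.1 hfirst _ hz).not_gt hs.2
  have hev : ∀ᶠ s in nhdsWithin t (Set.Iio t), s ∈ Set.Ioo 0 t := Ioo_mem_nhdsLT htpos
  have hge : ∀ y, 1 - ε * (1 + t) ≤ θ t y := by
    intro y
    have hc : Continuous fun s => θ s y := hcont.comp (continuous_id.prodMk continuous_const)
    exact le_of_tendsto_of_tendsto
      (((by fun_prop : Continuous fun s : ℝ => 1 - ε * (1 + s)).tendsto t).mono_left
        nhdsWithin_le_nhds)
      ((hc.tendsto t).mono_left nhdsWithin_le_nhds)
      (hev.mono fun s hs => (hbefore s hs y).le)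
  have heq : θ t x = 1 - ε * (1 + t) := le_antisymm htouch (hge x)
  have hpos : 0 < θ t x := by nlinarith
  have hnonneg := h.deriv_sq_nonneg_of_isMin hν hκ ⟨ht0, htT⟩ hpos
    fun y => heq.trans_le (hge y)
  have hsmooth : ContDiff ℝ (⊤ : ℕ∞) fun s => θ s x :=
    h.smooth_θ.comp (contDiff_id.prodMk contDiff_const)
  have hderiv : HasDerivAt (fun s => θ s x) (deriv (fun s => θ s x) t) t :=
    (hsmooth.differentiable (by simp) t).hasDerivAt
  have hsq : deriv (fun s => θ s x ^ 2) t = 2 * θ t x * deriv (fun s => θ s x) t := by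
    simpa using (hderiv.fun_pow 2).deriv
  rw [hsq] at hnonneg
  have hθt : 0 ≤ deriv (fun s => θ s x) t :=
    nonneg_of_mul_nonneg_right hnonneg (by positivity)
  have hslope : deriv (fun s => θ s x) t ≤ -ε := by
    have hlim := hderiv.tendsto_slope.mono_left
      (nhdsWithin_mono t fun s (hs : s ∈ Set.Iio t) => ne_of_lt hs)
    refine le_of_tendsto (x := nhdsWithin t (Set.Iio t)) hlim (hev.mono fun s hs => ?_)
    rw [slope_def_field, div_le_iff_of_neg (sub_neg.2 hs.2), heq]
    linarith [hbefore s hs x]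
  linarith
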